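/- Suppose V : ℝⁿ → [0,∞) is C^∞ and for every nonzero multi-index β ∈ ℕⁿ the derivative ∂^β V is bounded. Then for every t ∈ (0,T], every ξ ∈ ℝⁿ, every ω ∈ Ω outside a null set, and every multi-index α ∈ ℕⁿ, the map x ↦ exp(−∫₀ᵗ V(x − W(t,ω)/2 + W(s,ω)) ds) is C^∞, and for every nonzero α its α-th partial derivative is bounded in absolute value, uniformly in x and ω, by α! · exp( t · Σ_{0 ≠ β ≤ α} ‖∂^β V‖_∞ / β! ). -/

import Mathlib

open MeasureTheory ProbabilityTheory

/-- `expNeg L = e^{-L}` for `L ∈ [0,∞]`, with the convention `e^{-∞} = 0`. -/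
noncomputable def expNeg (L : ENNReal) : ℝ := if L = ⊤ then 0 else Real.exp (-L.toReal)

/-- Partial derivative in the `j`-th coordinate. -/
noncomputable def pd {ι : Type*} [DecidableEq ι] {E : Type*} [NormedAddCommGroup E]
    [NormedSpace ℝ E] (j : ι) (f : (ι → ℝ) → E) : (ι → ℝ) → E :=
  fun x => deriv (fun s : ℝ => f (Function.update x j s)) (x j)

/-- Iterated partial derivative `∂^β` associated with a multi-index `β`. -/
noncomputable def mderiv {ι : Type*} [Fintype ι] [DecidableEq ι] {E : Type*}
    [NormedAddCommGroup E] [NormedSpace ℝ E] (β : ι → ℕ) (f : (ι → ℝ) → E) : (ι → ℝ) → E :=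
  (Finset.univ : Finset ι).toList.foldr (fun j g => (pd j)^[β j] g) f

/-- `β! = ∏ j (β j)!` for a multi-index `β`. -/
def mfact {ι : Type*} [Fintype ι] (β : ι → ℕ) : ℕ := ∏ j, (β j).factorial

/-- `A k = 2^{k/2} Γ((k+1)/2) / √π`. -/
noncomputable def A (k : ℕ) : ℝ :=
  (2 : ℝ) ^ ((k : ℝ) / 2) * Real.Gamma (((k : ℝ) + 1) / 2) / Real.sqrt Real.pi

/-- `B m = max_{0 ≤ k ≤ m} A k`. -/
noncomputable def B (m : ℕ) : ℝ := ⨆ k : Fin (m + 1), A k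

/-- The hypotheses that `W` is an `n`-dimensional Brownian motion on `[0,T]`. -/
structure IsBrownian (n : ℕ) (T : ℝ) {Ω : Type*} [MeasurableSpace Ω]
    (P : Measure Ω) (W : ℝ → Ω → Fin n → ℝ) : Prop where
  meas : ∀ s : ℝ, Measurable (W s)
  start : ∀ᵐ ω ∂P, W 0 ω = 0
  cont : ∀ᵐ ω ∂P, ContinuousOn (fun s => W s ω) (Set.Icc 0 T)
  indepIncr : ∀ (m : ℕ) (τ : Fin (m + 1) → ℝ), Monotone τ → (∀ i, τ i ∈ Set.Icc 0 T) →
    iIndepFun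
      (fun i : Fin m => fun ω => W (τ i.succ) ω - W (τ i.castSucc) ω) P
  gaussCoord : ∀ s t : ℝ, 0 ≤ s → s ≤ t → t ≤ T → ∀ j : Fin n,
    P.map (fun ω => W t ω j - W s ω j) = gaussianReal 0 ((t - s).toNNReal)
  coordIndep : ∀ s t : ℝ, 0 ≤ s → s ≤ t → t ≤ T →
    iIndepFun (fun j : Fin n => fun ω => W t ω j - W s ω j) P

/-- The Feynman–Kac integrand `e^{-i W(t)·ξ} e^{-∫₀ᵗ V(x - W(t)/2 + W(s)) ds}`. -/
noncomputable def FK {n : ℕ} {Ω : Type*} (W : ℝ → Ω → Fin n → ℝ) (V : (Fin n → ℝ) → ℝ)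
    (t : ℝ) (x ξ : Fin n → ℝ) (ω : Ω) : ℂ :=
  Complex.exp (-(Complex.I * ((∑ j, W t ω j * ξ j : ℝ) : ℂ))) *
    ((expNeg (∫⁻ s in Set.Ioc (0 : ℝ) t,
        ENNReal.ofReal (V (fun j => x j - W t ω j / 2 + W s ω j))) : ℝ) : ℂ)

/-- The Weyl symbol `u(x, ξ, t)` of `e^{-tH}` given by the Feynman–Kac formula. -/
noncomputable def uSym {n : ℕ} {Ω : Type*} [MeasurableSpace Ω] (P : Measure Ω)
    (W : ℝ → Ω → Fin n → ℝ) (V : (Fin n → ℝ) → ℝ) (t : ℝ) (x ξ : Fin n → ℝ) : ℂ :=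
  ∫ ω, FK W V t x ξ ω ∂P

/-- The finite set of nonzero multi-indices `β` with `β ≤ α` (componentwise). -/
def lowerMulti {ι : Type*} [Fintype ι] [DecidableEq ι] (α : ι → ℕ) : Finset (ι → ℕ) :=
  (Finset.Iic α).erase 0

/-- The Constantine–Savits index set `F(α)`: functions `φ` on the nonzero multi-indices
`β ≤ α` (extended by `0` elsewhere) such that `∑_{0 ≠ β ≤ α} φ(β)·β = α`. -/
def FaaF {ι : Type*} [Fintype ι] [DecidableEq ι] (α : ι → ℕ) : Set ((ι → ℕ) → ℕ) :=
  {φ | (∀ β, β ∉ lowerMulti α → φ β = 0) ∧ ∑ β ∈ lowerMulti α, φ β • β = α}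

/-- `|S(α)|`: the number of sites `j` with `α j ≠ 0`. -/
def suppCard {ι : Type*} [Fintype ι] (α : ι → ℕ) : ℕ :=
  (Finset.univ.filter fun j => α j ≠ 0).card


section DampingAux

variable {n : ℕ}

/-- Derivative along a list of coordinate directions (head applied first). -/
noncomputable def dl : List (Fin n) → ((Fin n → ℝ) → ℝ) → ((Fin n → ℝ) → ℝ)
  | [], f => f
  | j :: l, f => dl l (pd j f)

/-- Smoothness. -/
def Sm (f : (Fin n → ℝ) → ℝ) : Prop := ContDiff ℝ (⊤ : ℕ∞) f

lemma Sm.diff {f : (Fin n → ℝ) → ℝ} (hf : Sm f) : Differentiable ℝ f :=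
  ContDiff.differentiable hf (by simp)

lemma pd_eq {f : (Fin n → ℝ) → ℝ} (hf : Differentiable ℝ f) (j : Fin n) :
    pd j f = fun x => fderiv ℝ f x (Pi.single j 1) := by
  funext x
  unfold pd
  have h1 : HasFDerivAt f (fderiv ℝ f x) (Function.update x j (x j)) := by
    rw [Function.update_eq_self]; exact (hf x).hasFDerivAt
  exact (h1.comp_hasDerivAt (x j) (hasDerivAt_update x j (x j))).deriv

lemma Sm.pd {f : (Fin n → ℝ) → ℝ} (hf : Sm f) (j : Fin n) : Sm (pd j f) := by
  rw [pd_eq hf.diff]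
  exact (ContDiff.fderiv_right (m := (⊤ : ℕ∞)) hf (by simp)).clm_apply contDiff_const

lemma Sm.add {f g : (Fin n → ℝ) → ℝ} (hf : Sm f) (hg : Sm g) : Sm (fun x => f x + g x) :=
  ContDiff.add hf hg
lemma Sm.mul {f g : (Fin n → ℝ) → ℝ} (hf : Sm f) (hg : Sm g) : Sm (fun x => f x * g x) :=
  ContDiff.mul hf hg
lemma Sm.exp {f : (Fin n → ℝ) → ℝ} (hf : Sm f) : Sm (fun x => Real.exp (f x)) :=
  ContDiff.exp hf

lemma pd_add {f g : (Fin n → ℝ) → ℝ} (hf : Sm f) (hg : Sm g) (j : Fin n) :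
    pd j (fun x => f x + g x) = fun x => pd j f x + pd j g x := by
  rw [pd_eq hf.diff, pd_eq hg.diff, pd_eq (hf.add hg).diff]
  funext x
  rw [fderiv_fun_add (hf.diff x) (hg.diff x)]; rfl

lemma pd_mul {f g : (Fin n → ℝ) → ℝ} (hf : Sm f) (hg : Sm g) (j : Fin n) :
    pd j (fun x => f x * g x) = fun x => pd j f x * g x + f x * pd j g x := by
  rw [pd_eq hf.diff, pd_eq hg.diff, pd_eq (hf.mul hg).diff]
  funext x
  rw [fderiv_fun_mul (hf.diff x) (hg.diff x)]
  simp; ring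

lemma pd_exp {f : (Fin n → ℝ) → ℝ} (hf : Sm f) (j : Fin n) :
    pd j (fun x => Real.exp (f x)) = fun x => pd j f x * Real.exp (f x) := by
  rw [pd_eq hf.diff, pd_eq hf.exp.diff]
  funext x
  rw [fderiv_exp (hf.diff x)]
  simp; ring

lemma pd_cmul (f : (Fin n → ℝ) → ℝ) (c : ℝ) (j : Fin n) :
    pd j (fun x => c * f x) = fun x => c * pd j f x := by
  funext x
  unfold pd
  exact deriv_const_mul_field c

lemma dl_cmul (l : List (Fin n)) (c : ℝ) : ∀ f : (Fin n → ℝ) → ℝ,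
    dl l (fun x => c * f x) = fun x => c * dl l f x := by
  induction l with
  | nil => intro f; rfl
  | cons j l ih => intro f; simp only [dl, pd_cmul, ih]

lemma dl_add (l : List (Fin n)) : ∀ f g : (Fin n → ℝ) → ℝ, Sm f → Sm g →
    dl l (fun x => f x + g x) = fun x => dl l f x + dl l g x := by
  induction l with
  | nil => intro f g _ _; rfl
  | cons j l ih =>
    intro f g hf hg; simp only [dl, pd_add hf hg, ih _ _ (hf.pd j) (hg.pd j)]

lemma Sm.dl (l : List (Fin n)) : ∀ {f : (Fin n → ℝ) → ℝ}, Sm f → Sm (dl l f) := by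
  induction l with
  | nil => intro f h; exact h
  | cons j l ih => intro f h; exact ih (h.pd j)

lemma dl_append (l₁ l₂ : List (Fin n)) : ∀ f : (Fin n → ℝ) → ℝ,
    dl (l₁ ++ l₂) f = dl l₂ (dl l₁ f) := by
  induction l₁ with
  | nil => intro f; rfl
  | cons j l ih => intro f; simp only [List.cons_append, dl, ih]

lemma dl_replicate (k : ℕ) (j : Fin n) : ∀ f : (Fin n → ℝ) → ℝ,
    dl (List.replicate k j) f = (pd j)^[k] f := by
  induction k with
  | zero => intro f; rfl
  | succ k ih => intro f; simp only [List.replicate_succ, dl, ih, Function.iterate_succ_apply]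

lemma dl_prod_bound (x y : Fin n → ℝ) (l : List (Fin n)) : ∀ f g p q : (Fin n → ℝ) → ℝ,
    Sm f → Sm g → Sm p → Sm q →
    (∀ l', l'.Sublist l → |dl l' f x| ≤ dl l' p y) →
    (∀ l', l'.Sublist l → |dl l' g x| ≤ dl l' q y) →
    |dl l (fun z => f z * g z) x| ≤ dl l (fun z => p z * q z) y := by
  induction l with
  | nil =>
    intro f g p q _ _ _ _ h1 h2
    have h1 := h1 [] (List.Sublist.refl _)
    have h2 := h2 [] (List.Sublist.refl _)
    simp only [dl] at *
    rw [abs_mul]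
    exact mul_le_mul h1 h2 (abs_nonneg _) ((abs_nonneg _).trans h1)
  | cons j l ih =>
    intro f g p q hf hg hp hq h1 h2
    simp only [dl]
    rw [pd_mul hf hg, pd_mul hp hq, dl_add _ _ _ ((hf.pd j).mul hg) (hf.mul (hg.pd j)),
      dl_add _ _ _ ((hp.pd j).mul hq) (hp.mul (hq.pd j))]
    refine (abs_add_le _ _).trans (add_le_add ?_ ?_)
    · exact ih _ _ _ _ (hf.pd j) hg (hp.pd j) hq (fun l' h => h1 (j :: l') (h.cons_cons j))
        (fun l' h => h2 l' (h.cons j))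
    · exact ih _ _ _ _ hf (hg.pd j) hp (hq.pd j) (fun l' h => h1 l' (h.cons j))
        (fun l' h => h2 (j :: l') (h.cons_cons j))

lemma dl_exp_bound (x y : Fin n → ℝ) {f p : (Fin n → ℝ) → ℝ} (hf : Sm f) (hp : Sm p)
    (h0 : f x ≤ p y) (l : List (Fin n)) :
    (∀ l', l'.Sublist l → l' ≠ [] → |dl l' f x| ≤ dl l' p y) →
    ∀ l', l'.Sublist l →
      |dl l' (fun z => Real.exp (f z)) x| ≤ dl l' (fun z => Real.exp (p z)) y := by
  have hnil : |dl [] (fun z => Real.exp (f z)) x| ≤ dl [] (fun z => Real.exp (p z)) y := by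
    simp only [dl, Real.abs_exp]
    exact Real.exp_le_exp.2 h0
  induction l with
  | nil =>
    intro _ l' hl'
    rw [List.sublist_nil.1 hl']; exact hnil
  | cons j l ih =>
    intro h l' hl'
    have ih := ih (fun l' h1 h2 => h l' (h1.cons j) h2)
    cases hl' with
    | cons _ h' => exact ih _ h'
    | cons_cons _ h' =>
      rename_i r
      simp only [dl]
      rw [pd_exp hf, pd_exp hp]
      refine dl_prod_bound x y r _ _ _ _ (hf.pd j) hf.exp (hp.pd j) hp.exp ?_ ?_
      · intro l' hl'
        exact h (j :: l') ((hl'.trans h').cons_cons j) (by simp)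
      · intro l' hl'
        exact ih _ (hl'.trans h')

/-- Absolutely monotone functions on the nonnegative orthant. -/
def AM (p : (Fin n → ℝ) → ℝ) : Prop := Sm p ∧ ∀ l y, (∀ i, 0 ≤ y i) → 0 ≤ dl l p y

lemma AM.pd {p : (Fin n → ℝ) → ℝ} (hp : AM p) (j : Fin n) : AM (pd j p) :=
  ⟨hp.1.pd j, fun l y hy => hp.2 (j :: l) y hy⟩

lemma AM.dl {p : (Fin n → ℝ) → ℝ} (hp : AM p) (l : List (Fin n)) : AM (dl l p) :=
  ⟨hp.1.dl l, fun l' y hy => by rw [← dl_append]; exact hp.2 _ y hy⟩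

lemma AM.add {p q : (Fin n → ℝ) → ℝ} (hp : AM p) (hq : AM q) : AM (fun x => p x + q x) :=
  ⟨hp.1.add hq.1, fun l y hy => by
    rw [dl_add _ _ _ hp.1 hq.1]; exact add_nonneg (hp.2 l y hy) (hq.2 l y hy)⟩

lemma AM.mul {p q : (Fin n → ℝ) → ℝ} (hp : AM p) (hq : AM q) : AM (fun x => p x * q x) :=
  ⟨hp.1.mul hq.1, fun l y hy => (abs_nonneg _).trans
    (dl_prod_bound y y l p q p q hp.1 hq.1 hp.1 hq.1
      (fun l' _ => (abs_of_nonneg (hp.2 l' y hy)).le)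
      (fun l' _ => (abs_of_nonneg (hq.2 l' y hy)).le))⟩

lemma AM.exp {p : (Fin n → ℝ) → ℝ} (hp : AM p) : AM (fun x => Real.exp (p x)) :=
  ⟨hp.1.exp, fun l y hy => (abs_nonneg _).trans
    (dl_exp_bound y y hp.1 hp.1 le_rfl l
      (fun l' _ _ => (abs_of_nonneg (hp.2 l' y hy)).le) l (List.Sublist.refl _))⟩

lemma AM.const {c : ℝ} (hc : 0 ≤ c) : AM (fun _ : Fin n → ℝ => c) := by
  refine ⟨contDiff_const, ?_⟩
  intro l
  induction l generalizing c with
  | nil => intro y _; exact hc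
  | cons j l ih =>
    have : _root_.pd j (fun _ : Fin n → ℝ => c) = fun _ => 0 := by
      funext x; simp [_root_.pd]
    intro y hy
    simp only [_root_.dl, this]
    exact ih le_rfl y hy

lemma AM.coord (i : Fin n) : AM (fun y : Fin n → ℝ => y i) := by
  refine ⟨contDiff_apply ℝ ℝ i, ?_⟩
  intro l y hy
  cases l with
  | nil => exact hy i
  | cons j l =>
    have : _root_.pd j (fun y : Fin n → ℝ => y i) = fun _ => if i = j then 1 else 0 := by
      rw [pd_eq (contDiff_apply ℝ ℝ i : ContDiff ℝ 1 _).differentiable_one]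
      funext x
      rw [(hasFDerivAt_apply (𝕜 := ℝ) i x).fderiv]
      simp [Pi.single_apply]
    simp only [_root_.dl, this]
    exact (AM.const (by split_ifs <;> norm_num)).2 l y hy

lemma AM.pow {p : (Fin n → ℝ) → ℝ} (hp : AM p) (k : ℕ) : AM (fun x => p x ^ k) := by
  induction k with
  | zero => simpa using AM.const zero_le_one
  | succ k ih => simpa only [pow_succ] using ih.mul hp

lemma AM.prod {κ : Type*} (s : Finset κ) {p : κ → (Fin n → ℝ) → ℝ} (hp : ∀ k, AM (p k)) :
    AM (fun x => ∏ k ∈ s, p k x) := by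
  classical
  induction s using Finset.induction_on with
  | empty => simpa using AM.const zero_le_one
  | insert a s ha ih => simpa only [Finset.prod_insert ha] using (hp a).mul ih

lemma AM.sum {κ : Type*} (s : Finset κ) {p : κ → (Fin n → ℝ) → ℝ} (hp : ∀ k, AM (p k)) :
    AM (fun x => ∑ k ∈ s, p k x) := by
  classical
  induction s using Finset.induction_on with
  | empty => simpa using AM.const le_rfl
  | insert a s ha ih => simpa only [Finset.sum_insert ha] using (hp a).add ih

lemma dl_sum {κ : Type*} (s : Finset κ) {p : κ → (Fin n → ℝ) → ℝ} (hp : ∀ k, AM (p k))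
    (l : List (Fin n)) (x : Fin n → ℝ) :
    dl l (fun x => ∑ k ∈ s, p k x) x = ∑ k ∈ s, dl l (p k) x := by
  classical
  induction s using Finset.induction_on with
  | empty =>
    simp only [Finset.sum_empty]
    have := congrFun (dl_cmul l 0 (fun _ => 0)) x
    simpa using this
  | insert a s ha ih =>
    simp only [Finset.sum_insert ha]
    rw [dl_add _ _ _ (hp a).1 (AM.sum s hp).1]
    exact congrArg _ ih

lemma AM.taylor (j : Fin n) (k : ℕ) : ∀ {h : (Fin n → ℝ) → ℝ}, AM h →
    ∀ y : Fin n → ℝ, (∀ i, 0 ≤ y i) → ∀ s : ℝ, 0 ≤ s →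
    (_root_.pd j)^[k] h y * (s ^ k / (k.factorial : ℝ)) ≤ h (y + s • Pi.single j 1) := by
  have hnn : ∀ y : Fin n → ℝ, (∀ i, 0 ≤ y i) → ∀ s : ℝ, 0 ≤ s →
      ∀ i, 0 ≤ (y + s • (Pi.single j 1 : Fin n → ℝ)) i := by
    intro y hy s hs i
    have := hy i
    by_cases hij : i = j
    · subst hij; simp; linarith
    · simp [hij, this]
  have hder : ∀ {h : (Fin n → ℝ) → ℝ}, AM h → ∀ y s, HasDerivAt
      (fun s : ℝ => h (y + s • (Pi.single j 1 : Fin n → ℝ)))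
      (_root_.pd j h (y + s • Pi.single j 1)) s := by
    intro h hh y s
    rw [pd_eq hh.1.diff]
    refine (hh.1.diff _).hasFDerivAt.comp_hasDerivAt s ?_
    simpa using ((hasDerivAt_id s).smul_const (Pi.single j 1 : Fin n → ℝ)).const_add y
  induction k with
  | zero =>
    intro h hh y hy s hs
    simp only [Function.iterate_zero, id, pow_zero, Nat.factorial_zero, Nat.cast_one, div_one,
      mul_one]
    have hm : MonotoneOn (fun s : ℝ => h (y + s • (Pi.single j 1 : Fin n → ℝ))) (Set.Ici 0) := by
      refine monotoneOn_of_deriv_nonneg (convex_Ici 0)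
        (fun s _ => (hder hh y s).continuousAt.continuousWithinAt)
        (fun s _ => (hder hh y s).differentiableAt.differentiableWithinAt) ?_
      intro s hs
      rw [interior_Ici] at hs
      rw [(hder hh y s).deriv]
      exact (hh.pd j).2 [] _ (hnn y hy s (le_of_lt hs))
    simpa using hm (Set.mem_Ici.2 le_rfl) (Set.mem_Ici.2 hs) hs
  | succ k ih =>
    intro h hh y hy s hs
    simp only [Function.iterate_succ_apply]
    set c := (_root_.pd j)^[k] (_root_.pd j h) y with hc
    have hd : ∀ s : ℝ, HasDerivAt
        (fun s : ℝ => h (y + s • (Pi.single j 1 : Fin n → ℝ)) -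
          c * (s ^ (k+1) / ((k+1).factorial : ℝ)))
        (_root_.pd j h (y + s • Pi.single j 1) - c * (s ^ k / (k.factorial : ℝ))) s := by
      intro s
      refine (hder hh y s).sub ?_
      have := (((hasDerivAt_pow (k+1) s).div_const ((k+1).factorial : ℝ))).const_mul c
      refine this.congr_deriv ?_
      rw [Nat.factorial_succ]
      have : (k.factorial : ℝ) ≠ 0 := by positivity
      push_cast
      field_simp
    have hm : MonotoneOn (fun s : ℝ => h (y + s • (Pi.single j 1 : Fin n → ℝ)) -
          c * (s ^ (k+1) / ((k+1).factorial : ℝ))) (Set.Ici 0) := by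
      refine monotoneOn_of_deriv_nonneg (convex_Ici 0)
        (fun s _ => (hd s).continuousAt.continuousWithinAt)
        (fun s _ => (hd s).differentiableAt.differentiableWithinAt) ?_
      intro s hs
      rw [interior_Ici] at hs
      rw [(hd s).deriv]
      have := ih (hh.pd j) y hy s (le_of_lt hs)
      linarith
    have h1 := hm (Set.mem_Ici.2 le_rfl) (Set.mem_Ici.2 hs) hs
    have h2 : 0 ≤ h y := hh.2 [] y hy
    simp at h1
    linarith

/-- The canonical list of directions of a multi-index. -/
def canon (α : Fin n → ℕ) : List (Fin n) → List (Fin n)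
  | [] => []
  | j :: js => canon α js ++ List.replicate (α j) j

lemma foldr_eq_dl (α : Fin n → ℕ) (js : List (Fin n)) (f : (Fin n → ℝ) → ℝ) :
    js.foldr (fun j g => (pd j)^[α j] g) f = dl (canon α js) f := by
  induction js with
  | nil => rfl
  | cons j js ih => simp only [List.foldr_cons, canon, dl_append, dl_replicate, ih]

lemma mderiv_eq_dl (α : Fin n → ℕ) (f : (Fin n → ℝ) → ℝ) :
    mderiv α f = dl (canon α (Finset.univ : Finset (Fin n)).toList) f :=
  foldr_eq_dl _ _ _

lemma canon_congr {α β : Fin n → ℕ} (js : List (Fin n)) (h : ∀ j ∈ js, α j = β j) :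
    canon α js = canon β js := by
  induction js with
  | nil => rfl
  | cons j js ih =>
    simp only [canon]
    rw [ih (fun i hi => h i (List.mem_cons_of_mem _ hi)), h j List.mem_cons_self]

lemma sublist_canon (α : Fin n → ℕ) (js : List (Fin n)) (hjs : js.Nodup) :
    ∀ l, l.Sublist (canon α js) → ∃ β : Fin n → ℕ, β ≤ α ∧ l = canon β js := by
  induction js with
  | nil => intro l hl; exact ⟨α, le_rfl, List.sublist_nil.1 hl⟩
  | cons j js ih =>
    intro l hl
    obtain ⟨hj, hjs⟩ := List.nodup_cons.1 hjs
    obtain ⟨l1, l2, rfl, h1, h2⟩ := List.sublist_append_iff.1 hl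
    obtain ⟨β, hβ, rfl⟩ := ih hjs l1 h1
    obtain ⟨m, hm, rfl⟩ := List.sublist_replicate_iff.1 h2
    refine ⟨Function.update β j m, ?_, ?_⟩
    · intro i
      by_cases hij : i = j
      · subst hij; simpa using hm
      · simpa [hij] using hβ i
    · simp only [canon, Function.update_self]
      congr 1
      apply canon_congr
      intro i hi
      have : i ≠ j := by rintro rfl; exact hj hi
      simp [this]

lemma canon_zero (js : List (Fin n)) : canon (0 : Fin n → ℕ) js = [] := by
  induction js with
  | nil => rfl
  | cons j js ih => simp [canon, ih]

lemma foldr_taylor (α : Fin n → ℕ) {g : (Fin n → ℝ) → ℝ} (hg : AM g) (js : List (Fin n)) :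
    ∀ y : Fin n → ℝ, (∀ i, 0 ≤ y i) → dl (canon α js) g y ≤
      ((js.map (fun j => ((α j).factorial : ℝ))).prod) *
        g (y + (js.map (fun j => (Pi.single j 1 : Fin n → ℝ))).sum) := by
  induction js with
  | nil => intro y _; simp [canon, dl]
  | cons j js ih =>
    intro y hy
    have h1 := AM.taylor j (α j) (hg.dl (canon α js)) y hy 1 zero_le_one
    simp only [one_pow, one_smul] at h1
    have h2 := ih (y + Pi.single j 1) (fun i => by
      have := hy i
      by_cases hij : i = j
      · subst hij; simp; linarith
      · simp [hij, this])
    simp only [canon, dl_append, dl_replicate, List.map_cons, List.prod_cons, List.sum_cons]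
    have hpos : (0 : ℝ) < ((α j).factorial : ℝ) := by positivity
    have h3 := h1.trans h2
    rw [mul_one_div, div_le_iff₀ hpos] at h3
    rw [← add_assoc]
    refine h3.trans (le_of_eq ?_)
    ring

lemma mderiv_am_le (α : Fin n → ℕ) {g : (Fin n → ℝ) → ℝ} (hg : AM g) :
    mderiv α g 0 ≤ (mfact α : ℝ) * g (fun _ => 1) := by
  rw [mderiv_eq_dl]
  have h := foldr_taylor α hg (Finset.univ : Finset (Fin n)).toList 0 (fun _ => le_rfl)
  have h1 : (((Finset.univ : Finset (Fin n)).toList.map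
      (fun j => ((α j).factorial : ℝ))).prod) = (mfact α : ℝ) := by
    rw [Finset.prod_map_toList, mfact]; push_cast; rfl
  have h2 : (((Finset.univ : Finset (Fin n)).toList.map
      (fun j => (Pi.single j 1 : Fin n → ℝ))).sum) = fun _ => 1 := by
    rw [Finset.sum_map_toList]
    funext i
    simp [Finset.sum_apply, Pi.single_apply]
  rw [h1, h2, zero_add] at h
  exact h

lemma pd_sep (h : Fin n → ℝ → ℝ) (j : Fin n) :
    pd j (fun y => ∏ i, h i (y i)) =
      fun y => ∏ i, (Function.update h j (deriv (h j))) i (y i) := by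
  funext y
  unfold pd
  have e1 : ∀ s : ℝ, ∏ i, h i (Function.update y j s i) =
      h j s * ∏ i ∈ Finset.univ.erase j, h i (y i) := by
    intro s
    rw [← Finset.mul_prod_erase _ _ (Finset.mem_univ j), Function.update_self]
    congr 1
    refine Finset.prod_congr rfl fun i hi => ?_
    rw [Function.update_of_ne (Finset.ne_of_mem_erase hi)]
  simp only [e1]
  rw [deriv_mul_const_field, ← Finset.mul_prod_erase _ _ (Finset.mem_univ j),
    Function.update_self]
  congr 1
  refine Finset.prod_congr rfl fun i hi => ?_
  rw [Function.update_of_ne (Finset.ne_of_mem_erase hi)]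

lemma pd_iter_sep (j : Fin n) (k : ℕ) : ∀ (h : Fin n → ℝ → ℝ),
    (pd j)^[k] (fun y => ∏ i, h i (y i)) =
      fun y => ∏ i, (Function.update h j (deriv^[k] (h j))) i (y i) := by
  induction k with
  | zero => intro h; simp
  | succ k ih =>
    intro h
    rw [Function.iterate_succ_apply, pd_sep, ih]
    simp

lemma dl_canon_sep (h : Fin n → ℝ → ℝ) (β : Fin n → ℕ) (js : List (Fin n)) (hjs : js.Nodup) :
    dl (canon β js) (fun y => ∏ i, h i (y i)) =
      fun y => ∏ i, (if i ∈ js then deriv^[β i] (h i) else h i) (y i) := by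
  induction js with
  | nil => simp [canon, dl]
  | cons j js ih =>
    obtain ⟨hj, hjs⟩ := List.nodup_cons.1 hjs
    rw [canon, dl_append, dl_replicate, ih hjs,
      pd_iter_sep j (β j) (fun i => if i ∈ js then deriv^[β i] (h i) else h i)]
    funext y
    refine Finset.prod_congr rfl fun i _ => ?_
    by_cases hij : i = j
    · subst hij; simp [hj]
    · simp [hij]

lemma mderiv_monomial (β : Fin n → ℕ) :
    mderiv β (fun y : Fin n → ℝ => ∏ i, y i ^ β i) = fun _ => (mfact β : ℝ) := by
  rw [mderiv_eq_dl, dl_canon_sep (fun i s => s ^ β i) β _ (Finset.nodup_toList _)]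
  funext y
  rw [mfact]
  push_cast
  refine Finset.prod_congr rfl fun i _ => ?_
  simp only [Finset.mem_toList, Finset.mem_univ, if_true]
  rw [iter_deriv_pow]
  simp only [Nat.sub_self, pow_zero, mul_one]
  rw [← Nat.descFactorial_self, Nat.descFactorial_eq_prod_range]
  push_cast
  refine Finset.prod_congr rfl fun k hk => ?_
  rw [Nat.cast_sub (Finset.mem_range.1 hk).le]

/-- Main combinatorial estimate. -/
lemma mderiv_exp_bound (α : Fin n → ℕ) {f : (Fin n → ℝ) → ℝ} (hf : Sm f) (x : Fin n → ℝ)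
    (hx : f x ≤ 0) (b : (Fin n → ℕ) → ℝ) (hb : ∀ β, 0 ≤ b β)
    (h : ∀ β, β ≠ 0 → |mderiv β f x| ≤ b β) :
    |mderiv α (fun z => Real.exp (f z)) x| ≤
      (mfact α : ℝ) * Real.exp (∑ β ∈ lowerMulti α, b β / (mfact β : ℝ)) := by
  have hmf : ∀ β : Fin n → ℕ, (0 : ℝ) < (mfact β : ℝ) := fun β => by
    unfold mfact; exact_mod_cast Finset.prod_pos fun i _ => Nat.factorial_pos _
  have hmon : ∀ β : Fin n → ℕ,
      AM (fun y : Fin n → ℝ => b β / (mfact β : ℝ) * ∏ i, y i ^ β i) := fun β =>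
    (AM.const (div_nonneg (hb β) (hmf β).le)).mul
      (AM.prod _ (p := fun i y => y i ^ β i) fun i => (AM.coord i).pow _)
  set p : (Fin n → ℝ) → ℝ :=
    fun y => ∑ β ∈ lowerMulti α, b β / (mfact β : ℝ) * ∏ i, y i ^ β i with hp
  have hpam : AM p := AM.sum _ hmon
  have key := dl_exp_bound x 0 hf hpam.1 (hx.trans (hpam.2 [] 0 fun _ => le_rfl))
    (canon α (Finset.univ : Finset (Fin n)).toList) (by
      intro l' hl' hne
      obtain ⟨β, hβ, rfl⟩ := sublist_canon α _ (Finset.nodup_toList _) l' hl'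
      have hβ0 : β ≠ 0 := by rintro rfl; exact hne (canon_zero _)
      have hmem : β ∈ lowerMulti α := by
        rw [lowerMulti, Finset.mem_erase, Finset.mem_Iic]; exact ⟨hβ0, hβ⟩
      rw [← mderiv_eq_dl]
      refine (h β hβ0).trans ?_
      rw [hp, dl_sum _ hmon]
      refine le_trans (le_of_eq ?_) (Finset.single_le_sum
        (fun γ _ => (hmon γ).2 _ 0 fun _ => le_rfl) hmem)
      rw [← mderiv_eq_dl, mderiv_eq_dl, dl_cmul, ← mderiv_eq_dl, mderiv_monomial]
      have := (hmf β).ne'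
      field_simp) _ (List.Sublist.refl _)
  rw [mderiv_eq_dl]
  refine key.trans ?_
  rw [← mderiv_eq_dl]
  refine (mderiv_am_le α hpam.exp).trans (le_of_eq ?_)
  simp [hp]

lemma hasFDerivAt_avg {E G : Type} [NormedAddCommGroup E] [NormedSpace ℝ E]
    [ProperSpace E] [NormedAddCommGroup G] [NormedSpace ℝ G]
    (t : ℝ) (c : ℝ → E) (hc : Continuous c) (V : E → G) (hV : ContDiff ℝ 1 V) (x : E) :
    HasFDerivAt (fun x => ∫ s in Set.Ioc 0 t, V (x + c s))
      (∫ s in Set.Ioc 0 t, fderiv ℝ V (x + c s)) x := by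
  have hd : Differentiable ℝ V := hV.differentiable_one
  have hfc : Continuous (fderiv ℝ V) := hV.continuous_fderiv one_ne_zero
  have hcV : ∀ x, Continuous (fun s => V (x + c s)) := fun x => hV.continuous.comp (by fun_prop)
  have hcF : ∀ x, Continuous (fun s => fderiv ℝ V (x + c s)) := fun x => hfc.comp (by fun_prop)
  have hcJ : Continuous (fun q : E × ℝ => fderiv ℝ V (q.1 + c q.2)) := hfc.comp (by fun_prop)
  obtain ⟨C, hC⟩ := ((isCompact_closedBall x 1).prod (isCompact_Icc (a := (0:ℝ)) (b := t))).exists_bound_of_continuousOn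
    hcJ.continuousOn
  have hm : MeasurableSet (Set.Ioc (0:ℝ) t) := measurableSet_Ioc
  refine hasFDerivAt_integral_of_dominated_of_fderiv_le (𝕜 := ℝ) (bound := fun _ => C)
    (F := fun x s => V (x + c s)) (F' := fun x s => fderiv ℝ V (x + c s))
    (Metric.closedBall_mem_nhds x one_pos) (Filter.Eventually.of_forall fun y => ?_) ?_ ?_ ?_ ?_ ?_
  · exact (hcV y).aestronglyMeasurable
  · exact ((hcV x).integrableOn_Icc (μ := volume)).mono_set Set.Ioc_subset_Icc_self
  · exact (hcF x).aestronglyMeasurable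
  · refine (ae_restrict_iff' hm).2 (Filter.Eventually.of_forall fun s hs y hy => ?_)
    exact hC (y, s) ⟨hy, Set.Ioc_subset_Icc_self hs⟩
  · exact integrable_const C
  · refine Filter.Eventually.of_forall fun s y _ => ?_
    exact (hasFDerivAt_comp_add_right (c s)).2 (hd _).hasFDerivAt

lemma contDiff_avg {E : Type} [NormedAddCommGroup E] [NormedSpace ℝ E]
    [ProperSpace E] (t : ℝ) (c : ℝ → E) (hc : Continuous c) (k : ℕ) :
    ∀ {G : Type} [NormedAddCommGroup G] [NormedSpace ℝ G]
    (V : E → G), ContDiff ℝ (⊤ : ℕ∞) V →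
    ContDiff ℝ k (fun x => ∫ s in Set.Ioc 0 t, V (x + c s)) := by
  induction k with
  | zero =>
    intro G _ _ V hV
    rw [Nat.cast_zero, contDiff_zero, continuous_iff_continuousAt]
    exact fun x => (hasFDerivAt_avg t c hc V (hV.of_le (by simp)) x).continuousAt
  | succ k ih =>
    intro G _ _ V hV
    rw [Nat.cast_succ, contDiff_succ_iff_hasFDerivAt]
    exact ⟨_, ih (fderiv ℝ V) (hV.fderiv_right (by simp)),
      fun x => hasFDerivAt_avg t c hc V (hV.of_le (by simp)) x⟩

lemma sm_avg (t : ℝ) (c : ℝ → Fin n → ℝ) (hc : Continuous c) {V : (Fin n → ℝ) → ℝ}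
    (hV : Sm V) : Sm (fun x => ∫ s in Set.Ioc 0 t, V (x + c s)) :=
  contDiff_infty.2 fun k => contDiff_avg t c hc k V hV

lemma dl_avg (t : ℝ) (c : ℝ → Fin n → ℝ) (hc : Continuous c) (l : List (Fin n)) :
    ∀ {V : (Fin n → ℝ) → ℝ}, Sm V →
    dl l (fun x => ∫ s in Set.Ioc 0 t, V (x + c s)) =
      fun x => ∫ s in Set.Ioc 0 t, dl l V (x + c s) := by
  induction l with
  | nil => intro V _; rfl
  | cons j l ih =>
    intro V hV
    have hV1 : ContDiff ℝ 1 V := ContDiff.of_le hV (by simp)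
    have : pd j (fun x => ∫ s in Set.Ioc 0 t, V (x + c s)) =
        fun x => ∫ s in Set.Ioc 0 t, pd j V (x + c s) := by
      rw [pd_eq (sm_avg t c hc hV).diff, pd_eq hV.diff]
      funext x
      rw [(hasFDerivAt_avg t c hc V hV1 x).fderiv]
      rw [ContinuousLinearMap.integral_apply]
      have hcF : Continuous (fun s => fderiv ℝ V (x + c s)) :=
        (hV1.continuous_fderiv one_ne_zero).comp (by fun_prop)
      exact (hcF.integrableOn_Icc (μ := volume)).mono_set Set.Ioc_subset_Icc_self
    simp only [dl, this]
    exact ih (hV.pd j)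

lemma damping_det (t : ℝ) (ht : 0 ≤ t) (c : ℝ → Fin n → ℝ) (hc : Continuous c)
    (V : (Fin n → ℝ) → ℝ) (hV0 : ∀ y, 0 ≤ V y) (hV : Sm V)
    (hVbdd : ∀ β : Fin n → ℕ, β ≠ 0 → ∃ M : ℝ, ∀ y, |mderiv β V y| ≤ M) :
    Sm (fun x => Real.exp (-1 * ∫ s in Set.Ioc 0 t, V (x + c s))) ∧
    ∀ α x, |mderiv α (fun x => Real.exp (-1 * ∫ s in Set.Ioc 0 t, V (x + c s))) x| ≤
      (mfact α : ℝ) *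
        Real.exp (t * ∑ β ∈ lowerMulti α, (⨆ y, |mderiv β V y|) / (mfact β : ℝ)) := by
  have hF := sm_avg t c hc hV
  have hf : Sm (fun x => -1 * ∫ s in Set.Ioc 0 t, V (x + c s)) :=
    Sm.mul contDiff_const hF
  refine ⟨hf.exp, fun α x => ?_⟩
  have := mderiv_exp_bound α hf x (by
      have : 0 ≤ ∫ s in Set.Ioc 0 t, V (x + c s) := integral_nonneg fun s => hV0 _
      linarith) (fun β => t * ⨆ y, |mderiv β V y|)
    (fun β => mul_nonneg ht (Real.iSup_nonneg fun y => abs_nonneg _)) (by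
      intro β hβ
      obtain ⟨M, hM⟩ := hVbdd β hβ
      have hbd : BddAbove (Set.range fun y => |mderiv β V y|) := ⟨M, by rintro _ ⟨y, rfl⟩; exact hM y⟩
      rw [mderiv_eq_dl, dl_cmul, dl_avg t c hc _ hV, ← mderiv_eq_dl]
      simp only [neg_one_mul, abs_neg]
      have h1 := norm_setIntegral_le_of_norm_le_const (μ := volume) (s := Set.Ioc 0 t)
        (f := fun s => mderiv β V (x + c s)) (C := ⨆ y, |mderiv β V y|) (by simp)
        (fun s _ => le_ciSup hbd (x + c s))
      rw [Real.norm_eq_abs] at h1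
      refine h1.trans (le_of_eq ?_)
      simp [ht, mul_comm])
  rw [Finset.mul_sum]
  simpa only [mul_div_assoc] using this

end DampingAux

/-- If `V : ℝⁿ → [0,∞)` is `C^∞` with all derivatives `∂^β V`, `β ≠ 0`,
bounded, then for every `t ∈ (0,T]`, every `ξ ∈ ℝⁿ` and almost every `ω`, the map
`x ↦ exp(-∫₀ᵗ V(x - W(t,ω)/2 + W(s,ω)) ds)` is `C^∞`, and for every nonzero multi-index `α`
its `α`-th partial derivative is bounded, uniformly in `x` (and in `ω`), by
`α! exp(t ∑_{0≠β≤α} ‖∂^β V‖_∞/β!)`. -/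
theorem damping_factor_smooth_and_deriv_bound
    (n : ℕ) (hn : 1 ≤ n) (T : ℝ) (hT : 0 < T)
    {Ω : Type*} [MeasurableSpace Ω] (P : Measure Ω) [IsProbabilityMeasure P]
    (W : ℝ → Ω → Fin n → ℝ) (hW : IsBrownian n T P W)
    (V : (Fin n → ℝ) → ℝ) (hV0 : ∀ y, 0 ≤ V y) (hVsmooth : ContDiff ℝ (⊤ : ℕ∞) V)
    (hVbdd : ∀ β : Fin n → ℕ, β ≠ 0 → ∃ M : ℝ, ∀ y, |mderiv β V y| ≤ M)
    (t : ℝ) (ht : t ∈ Set.Ioc (0 : ℝ) T) (ξ : Fin n → ℝ) :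
    ∀ᵐ ω ∂P,
      ContDiff ℝ (⊤ : ℕ∞) (fun x : Fin n → ℝ =>
        expNeg (∫⁻ s in Set.Ioc (0 : ℝ) t,
          ENNReal.ofReal (V (fun j => x j - W t ω j / 2 + W s ω j)))) ∧
      ∀ (α : Fin n → ℕ), α ≠ 0 → ∀ x : Fin n → ℝ,
        |mderiv α (fun x' : Fin n → ℝ =>
            expNeg (∫⁻ s in Set.Ioc (0 : ℝ) t,
              ENNReal.ofReal (V (fun j => x' j - W t ω j / 2 + W s ω j)))) x| ≤
          (mfact α : ℝ) *
            Real.exp (t * ∑ β ∈ lowerMulti α, (⨆ y, |mderiv β V y|) / (mfact β : ℝ)) := by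
  filter_upwards [hW.cont] with ω hω
  have hcI : ContinuousOn (fun s => W s ω) (Set.Icc 0 t) :=
    hω.mono (Set.Icc_subset_Icc_right ht.2)
  set w : ℝ → Fin n → ℝ := Set.IccExtend ht.1.le ((Set.Icc 0 t).domRestrict fun s => W s ω) with hw
  have hwc : Continuous w := (continuousOn_iff_continuous_domRestrict.1 hcI).Icc_extend'
  have hweq : ∀ s ∈ Set.Icc 0 t, w s = W s ω := fun s hs => by
    rw [hw, Set.IccExtend_of_mem _ _ hs]; rfl
  set c : ℝ → Fin n → ℝ := fun s j => - (W t ω j / 2) + w s j with hcdef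
  have hc : Continuous c := by
    refine continuous_pi fun j => ?_
    exact continuous_const.add ((continuous_apply j).comp hwc)
  have hfun : (fun x : Fin n → ℝ => expNeg (∫⁻ s in Set.Ioc (0 : ℝ) t,
      ENNReal.ofReal (V (fun j => x j - W t ω j / 2 + W s ω j)))) =
      fun x => Real.exp (-1 * ∫ s in Set.Ioc 0 t, V (x + c s)) := by
    funext x
    have h1 : ∫⁻ s in Set.Ioc (0 : ℝ) t,
        ENNReal.ofReal (V (fun j => x j - W t ω j / 2 + W s ω j)) =
        ∫⁻ s in Set.Ioc (0 : ℝ) t, ENNReal.ofReal (V (x + c s)) := by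
      refine setLIntegral_congr_fun measurableSet_Ioc fun s hs => ?_
      have : (fun j => x j - W t ω j / 2 + W s ω j) = x + c s := by
        funext j
        simp only [Pi.add_apply, hcdef, hweq s (Set.Ioc_subset_Icc_self hs)]
        ring
      simp only [this]
    have hcV : Continuous (fun s => V (x + c s)) := hVsmooth.continuous.comp (by fun_prop)
    have hint : IntegrableOn (fun s => V (x + c s)) (Set.Ioc 0 t) :=
      (hcV.integrableOn_Icc (μ := volume)).mono_set Set.Ioc_subset_Icc_self
    rw [h1, ← ofReal_integral_eq_lintegral_ofReal hint
      (Filter.Eventually.of_forall fun s => hV0 _), expNeg, if_neg ENNReal.ofReal_ne_top,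
      ENNReal.toReal_ofReal (integral_nonneg fun s => hV0 _), neg_one_mul]
  obtain ⟨h1, h2⟩ := damping_det t ht.1.le c hc V hV0 hVsmooth hVbdd
  rw [hfun]
  exact ⟨h1, fun α _ x => h2 α x⟩
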